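/- Fix a ranking σ_i for each agent i ∈ [n], and let 𝒯 be the resulting family of indexed n-tuples. If the item graph G(𝒯) admits a proper n-coloring (its chromatic number is at most n), then a symEF1 partition of the m items into n bundles exists; indeed, the color classes of any proper n-coloring form a symEF1 partition. -/

import Mathlib

/-- Additive value of agent `i` for bundle `A`. -/
def bundleVal {n m : ℕ} (v : Fin n → Fin m → ℝ) (i : Fin n) (A : Finset (Fin m)) : ℝ :=
  ∑ j ∈ A, v i j

/-- Value of agent `i`'s favorite item in `A` (0 if `A` is empty). -/
def maxVal {n m : ℕ} (v : Fin n → Fin m → ℝ) (i : Fin n) (A : Finset (Fin m)) : ℝ :=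
  if h : A.Nonempty then A.sup' h (v i) else 0

/-- Value of agent `i`'s least-valued item in `A` (0 if `A` is empty). -/
def minVal {n m : ℕ} (v : Fin n → Fin m → ℝ) (i : Fin n) (A : Finset (Fin m)) : ℝ :=
  if h : A.Nonempty then A.inf' h (v i) else 0

/-- `(A 1, …, A n)` is a partition of the items: every item is in exactly one bundle. -/
def IsPartition {n m : ℕ} (A : Fin n → Finset (Fin m)) : Prop :=
  ∀ j : Fin m, ∃! k : Fin n, j ∈ A k

/-- Symmetrically envy free up to one good. -/
def SymEF1 {n m : ℕ} (v : Fin n → Fin m → ℝ) (A : Fin n → Finset (Fin m)) : Prop :=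
  ∀ i k l : Fin n, bundleVal v i (A k) ≥ bundleVal v i (A l) - maxVal v i (A l)

/-- Symmetrically envy free up to any good. -/
def SymEFX {n m : ℕ} (v : Fin n → Fin m → ℝ) (A : Fin n → Finset (Fin m)) : Prop :=
  ∀ i k l : Fin n, bundleVal v i (A k) ≥ bundleVal v i (A l) - minVal v i (A l)

/-- `σ` is a ranking for agent `i`: `σ` lists the items from most to least favorite. -/
def IsRanking {n m : ℕ} (v : Fin n → Fin m → ℝ) (i : Fin n) (σ : Equiv.Perm (Fin m)) : Prop :=
  ∀ (j : ℕ) (h : j + 1 < m), v i (σ ⟨j + 1, h⟩) ≤ v i (σ ⟨j, Nat.lt_of_succ_lt h⟩)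

/-- The `t`-th indexed `n`-tuple (0-indexed `t`) for the ranking `σ`:
    the items ranked in positions `n*t, …, n*t + n - 1` (0-indexed, positions `< m`). -/
def nTuple {m : ℕ} (n : ℕ) (σ : Equiv.Perm (Fin m)) (t : ℕ) : Finset (Fin m) :=
  (Finset.univ.filter (fun p : Fin m => p.val / n = t)).image σ

/-- The `l`-th bundle (0-indexed `l`) of the round-robin allocation of the agent whose
    ranking is `σ`: the items ranked in positions congruent to `l` modulo `n`. -/
def rrBundle {m : ℕ} (n : ℕ) (σ : Equiv.Perm (Fin m)) (l : ℕ) : Finset (Fin m) :=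
  (Finset.univ.filter (fun p : Fin m => p.val % n = l)).image σ

/-- The partition `A` separates the indexed `n`-tuples induced by the ranking `σ`:
    no two distinct items of a common `n`-tuple lie in the same bundle. -/
def Separates {n m : ℕ} (σ : Equiv.Perm (Fin m)) (A : Fin n → Finset (Fin m)) : Prop :=
  ∀ (t : ℕ), ∀ j1 ∈ nTuple n σ t, ∀ j2 ∈ nTuple n σ t, j1 ≠ j2 →
    ∀ k : Fin n, j1 ∈ A k → j2 ∉ A k

/-- The item graph: vertices are the items, with an edge between two distinct items
    whenever they belong to a common indexed `n`-tuple of some agent. -/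
def itemGraph {m : ℕ} (n : ℕ) (σ : Fin n → Equiv.Perm (Fin m)) : SimpleGraph (Fin m) :=
  SimpleGraph.fromRel (fun j1 j2 => ∃ (i : Fin n) (t : ℕ),
    j1 ∈ nTuple n (σ i) t ∧ j2 ∈ nTuple n (σ i) t)

theorem IsRanking.antitone {n m : ℕ} {v : Fin n → Fin m → ℝ} {i : Fin n}
    {σ : Equiv.Perm (Fin m)} (h : IsRanking v i σ) : Antitone (fun p => v i (σ p)) := by
  rintro ⟨p, hp⟩ ⟨q, hq⟩ hpq
  replace hpq : p ≤ q := hpq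
  induction q, hpq using Nat.le_induction with
  | base => exact le_rfl
  | succ q _ ih => exact (h q hq).trans (ih (Nat.lt_of_succ_lt hq))

theorem maxVal_ge {n m : ℕ} (v : Fin n → Fin m → ℝ) (i : Fin n) {A : Finset (Fin m)}
    {j : Fin m} (hj : j ∈ A) : v i j ≤ maxVal v i A := by
  rw [maxVal, dif_pos ⟨j, hj⟩]
  exact Finset.le_sup' (v i) hj

theorem itemGraph_adj {n m : ℕ} (σ : Fin n → Equiv.Perm (Fin m)) (i : Fin n) {p q : Fin m}
    (hpq : p ≠ q) (h : p.val / n = q.val / n) : (itemGraph n σ).Adj (σ i p) (σ i q) := by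
  rw [itemGraph, SimpleGraph.fromRel_adj]
  refine ⟨(σ i).injective.ne hpq, Or.inl ⟨i, p.val / n, ?_, ?_⟩⟩
  · exact Finset.mem_image_of_mem _ (by simp)
  · exact Finset.mem_image_of_mem _ (by simp [h])

/-- Positions in the same block whose items have the same color coincide. -/
theorem position_eq_of_color_eq {n m : ℕ} {σ : Fin n → Equiv.Perm (Fin m)}
    (c : (itemGraph n σ).Coloring (Fin n)) (i : Fin n) {p q : Fin m}
    (h : p.val / n = q.val / n) (hc : c (σ i p) = c (σ i q)) : p = q := by
  by_contra hpq
  exact c.valid (itemGraph_adj σ i hpq h) hc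

/-- Every color occurs in every full block of positions. -/
theorem exists_position_of_full_block {n m : ℕ} {σ : Fin n → Equiv.Perm (Fin m)}
    (c : (itemGraph n σ).Coloring (Fin n)) (i k : Fin n) {t : ℕ} (ht : n * (t + 1) ≤ m) :
    ∃ p : Fin m, p.val / n = t ∧ c (σ i p) = k := by
  have hn : 0 < n := i.pos
  have hlt (r : Fin n) : n * t + r.val < m := by
    have := r.isLt
    rw [mul_add, mul_one] at ht
    omega
  have hdiv (r : Fin n) : (n * t + r.val) / n = t := by
    rw [Nat.mul_add_div hn, Nat.div_eq_of_lt r.isLt, add_zero]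
  have hinj : Function.Injective (fun r : Fin n => c (σ i ⟨n * t + r.val, hlt r⟩)) := by
    intro r s hrs
    have := position_eq_of_color_eq c i (by simp only [hdiv]) hrs
    rw [Fin.mk.injEq] at this
    exact Fin.ext (by omega)
  obtain ⟨r, hr⟩ := (Finite.injective_iff_surjective.mp hinj) k
  exact ⟨_, hdiv r, hr⟩

theorem isPartition_colorClasses {n m : ℕ} (c : Fin m → Fin n) :
    IsPartition (fun k : Fin n => Finset.univ.filter (fun j : Fin m => c j = k)) := by
  intro j
  simp

theorem symEF1_colorClasses {n m : ℕ} {v : Fin n → Fin m → ℝ} (hv : ∀ i j, 0 ≤ v i j)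
    {σ : Fin n → Equiv.Perm (Fin m)} (hσ : ∀ i, IsRanking v i (σ i))
    (c : (itemGraph n σ).Coloring (Fin n)) :
    SymEF1 v (fun k : Fin n => Finset.univ.filter (fun j : Fin m => c j = k)) := by
  intro i k l
  simp only [ge_iff_le, tsub_le_iff_right]
  set A := Finset.univ.filter (fun j : Fin m => c j = k)
  set B := Finset.univ.filter (fun j : Fin m => c j = l)
  rcases B.eq_empty_or_nonempty with hB | hB
  · simpa [hB, bundleVal, maxVal] using Finset.sum_nonneg fun j _ => hv i j
  obtain ⟨b, hb, hmin⟩ := B.exists_min_image (fun j => (σ i).symm j) hB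
  have hlater : ∀ j ∈ B.erase b, ∃ p : Fin m, c (σ i p) = k ∧
      p.val / n + 1 = ((σ i).symm j).val / n := by
    intro j hj
    obtain ⟨hjb, hjB⟩ := Finset.mem_erase.mp hj
    have hle : ((σ i).symm b).val / n ≤ ((σ i).symm j).val / n :=
      Nat.div_le_div_right (hmin j hjB)
    have hne : ((σ i).symm b).val / n ≠ ((σ i).symm j).val / n := by
      intro h
      refine hjb ((σ i).symm.injective (position_eq_of_color_eq c i h ?_)).symm
      simp only [Equiv.apply_symm_apply]
      exact (Finset.mem_filter.mp hb).2.trans (Finset.mem_filter.mp hjB).2.symm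
    obtain ⟨t, ht⟩ := Nat.exists_eq_succ_of_ne_zero (Nat.ne_zero_of_lt (hle.lt_of_ne hne))
    have hfull : n * (t + 1) ≤ m := by
      rw [← Nat.succ_eq_add_one, ← ht]
      exact (Nat.mul_div_le _ n).trans ((σ i).symm j).isLt.le
    obtain ⟨p, hp, hpk⟩ := exists_position_of_full_block c i k hfull
    exact ⟨p, hpk, by rw [hp, ht]⟩
  choose! f hfk hfblock using hlater
  have hinj : Set.InjOn (fun j => σ i (f j)) (B.erase b) := by
    intro j hj j' hj' h
    have hff : f j = f j' := (σ i).injective h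
    have hblock : ((σ i).symm j).val / n = ((σ i).symm j').val / n := by
      rw [← hfblock j hj, ← hfblock j' hj', hff]
    refine (σ i).symm.injective (position_eq_of_color_eq c i hblock ?_)
    simp only [Equiv.apply_symm_apply]
    exact (Finset.mem_filter.mp (Finset.mem_of_mem_erase hj)).2.trans
      (Finset.mem_filter.mp (Finset.mem_of_mem_erase hj')).2.symm
  have hval : ∀ j ∈ B.erase b, v i j ≤ v i (σ i (f j)) := by
    intro j hj
    have hle : f j ≤ (σ i).symm j := by
      by_contra! hlt
      have := Nat.div_le_div_right (c := n) (Fin.lt_def.mp hlt).le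
      have := hfblock j hj
      omega
    simpa using (hσ i).antitone hle
  have hsum : ∑ j ∈ B.erase b, v i j ≤ bundleVal v i A := calc
    ∑ j ∈ B.erase b, v i j ≤ ∑ j ∈ B.erase b, v i (σ i (f j)) := Finset.sum_le_sum hval
    _ = ∑ j ∈ (B.erase b).image (fun j => σ i (f j)), v i j := (Finset.sum_image hinj).symm
    _ ≤ ∑ j ∈ A, v i j := by
      refine Finset.sum_le_sum_of_subset_of_nonneg ?_ fun j _ _ => hv i j
      refine Finset.image_subset_iff.mpr fun j hj => ?_
      exact Finset.mem_filter.mpr ⟨Finset.mem_univ _, hfk j hj⟩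
  rw [bundleVal, ← Finset.sum_erase_add B (v i) hb]
  exact add_le_add hsum (maxVal_ge v i hb)

/-- if the item graph admits a proper `n`-coloring then a symEF1 partition
exists; indeed the color classes of any proper `n`-coloring form a symEF1 partition. -/
theorem statement7 {n m : ℕ} (v : Fin n → Fin m → ℝ)
    (hv : ∀ i j, 0 ≤ v i j ∧ v i j ≤ 1)
    (σ : Fin n → Equiv.Perm (Fin m)) (hσ : ∀ i, IsRanking v i (σ i))
    (hcol : (itemGraph n σ).Colorable n) :
    (∃ A : Fin n → Finset (Fin m), IsPartition A ∧ SymEF1 v A) ∧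
    ∀ c : (itemGraph n σ).Coloring (Fin n),
      IsPartition (fun k : Fin n => Finset.univ.filter (fun j : Fin m => c j = k)) ∧
      SymEF1 v (fun k : Fin n => Finset.univ.filter (fun j : Fin m => c j = k)) := by
  have hclasses (c : (itemGraph n σ).Coloring (Fin n)) :=
    And.intro (isPartition_colorClasses c) (symEF1_colorClasses (fun i j => (hv i j).1) hσ c)
  obtain ⟨c⟩ := hcol
  exact ⟨⟨_, hclasses c⟩, hclasses⟩
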